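/- Rank condition implies post-selected preparability: if C is a d₁ × d₂ complex matrix and S_in is a complex symmetric matrix with rank(C) ≤ rank(S_in), then there exist a number of auxiliary modes a ∈ ℕ, a unitary U ∈ U(d₁ + d₂ + a), and α > 0 such that the submatrix of Uᵀ · diag(S_in, 0) · U with rows indexed by the first d₁ modes and columns by the next d₂ modes equals α·C. -/

import Mathlib

open Matrix

theorem aux_factor {m n k l : Type} [Fintype m] [Fintype n] [Fintype k] [Fintype l]
    [DecidableEq m] [DecidableEq n] [DecidableEq k] [DecidableEq l]
    (S : Matrix m n ℂ) (C : Matrix k l ℂ) (h : C.rank ≤ S.rank) :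
    ∃ (P : Matrix k m ℂ) (Q : Matrix n l ℂ), P * S * Q = C := by
  unfold Matrix.rank at h
  obtain ⟨i, hi⟩ := finrank_le_iff_exists_linearMap.mp h
  obtain ⟨r, hr⟩ := S.mulVecLin.rangeRestrict.exists_rightInverse_of_surjective
    (LinearMap.range_rangeRestrict _)
  obtain ⟨p, hp⟩ := ((LinearMap.range S.mulVecLin).subtype ∘ₗ i).exists_leftInverse_of_injective
    (LinearMap.ker_eq_bot.mpr (Subtype.val_injective.comp hi))
  refine ⟨LinearMap.toMatrix' ((LinearMap.range C.mulVecLin).subtype ∘ₗ p),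
    LinearMap.toMatrix' (r ∘ₗ i ∘ₗ C.mulVecLin.rangeRestrict), ?_⟩
  apply Matrix.toLin'.injective
  rw [Matrix.toLin'_mul, Matrix.toLin'_mul, Matrix.toLin'_toMatrix', Matrix.toLin'_toMatrix']
  refine LinearMap.ext fun x => ?_
  have h1 : S *ᵥ (r (i (C.mulVecLin.rangeRestrict x))) = (i (C.mulVecLin.rangeRestrict x)).1 :=
    congrArg Subtype.val (LinearMap.congr_fun hr (i (C.mulVecLin.rangeRestrict x)))
  have h2 := LinearMap.congr_fun hp (C.mulVecLin.rangeRestrict x)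
  simp only [LinearMap.comp_apply, Matrix.toLin'_apply, Submodule.subtype_apply,
    LinearMap.id_apply] at h2 ⊢
  rw [h1, h2]
  rfl

open scoped MatrixOrder Matrix.Norms.L2Operator in
theorem aux_contr {n : Type} [Fintype n] [DecidableEq n] (W : Matrix n n ℂ) :
    ∃ t : ℝ, 0 < t ∧ ∃ B : Matrix n n ℂ,
      ((t : ℂ) • W)ᴴ * ((t : ℂ) • W) + Bᴴ * B = 1 := by
  have hc : (0 : ℝ) < ‖W‖ + 1 := by positivity
  refine ⟨(‖W‖ + 1)⁻¹, by positivity, ?_⟩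
  set V : Matrix n n ℂ := (((‖W‖ + 1)⁻¹ : ℝ) : ℂ) • W with hV
  have hn : ‖V‖ ≤ 1 := by
    rw [hV, norm_smul, Complex.norm_real, Real.norm_of_nonneg (by positivity), inv_mul_le_iff₀ hc]
    linarith
  have hle : star V * V ≤ 1 := by
    rw [← CStarAlgebra.norm_le_one_iff_of_nonneg _ (star_mul_self_nonneg V),
      CStarRing.norm_star_mul_self]
    nlinarith [norm_nonneg V]
  obtain ⟨B, hB⟩ := CStarAlgebra.nonneg_iff_eq_star_mul_self.mp (sub_nonneg.mpr hle)
  refine ⟨B, ?_⟩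
  rw [← star_eq_conjTranspose, ← star_eq_conjTranspose, ← hB]
  abel

theorem aux_unitary {n k : Type} [Fintype n] [DecidableEq n] [Fintype k] [DecidableEq k]
    (V : Matrix n n ℂ) (B : Matrix k n ℂ) (h : Vᴴ * V + Bᴴ * B = 1) :
    ∃ U ∈ Matrix.unitaryGroup (n ⊕ k) ℂ, (∀ i j, U (.inl i) (.inl j) = V i j) := by
  let v : n ⊕ k → EuclideanSpace ℂ (n ⊕ k) := fun q =>
    WithLp.toLp 2 (Sum.elim (fun j => Sum.elim (fun i => V i j) (fun i => B i j)) (fun _ => 0) q)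
  have hv : Orthonormal ℂ ((Set.range (Sum.inl : n → n ⊕ k)).domRestrict v) := by
    rw [orthonormal_iff_ite]
    rintro ⟨_, i, rfl⟩ ⟨_, j, rfl⟩
    have := congrFun (congrFun h i) j
    simp only [Matrix.add_apply, Matrix.mul_apply, Matrix.conjTranspose_apply,
      Matrix.one_apply] at this
    have hij : ((⟨Sum.inl i, i, rfl⟩ : Set.range (Sum.inl : n → n ⊕ k)) = ⟨Sum.inl j, j, rfl⟩) ↔ i = j := by
      exact ⟨fun e => Sum.inl.inj (congrArg Subtype.val e), fun e => Subtype.ext (congrArg Sum.inl e)⟩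
    simp only [hij]
    rw [← this]
    simp [v, PiLp.inner_apply, Fintype.sum_sum_type, mul_comm]
  obtain ⟨b, hb⟩ := hv.exists_orthonormalBasis_extension_of_card_eq (by simp)
  refine ⟨Matrix.of fun p q => b q p, ?_, ?_⟩
  · rw [Matrix.mem_unitaryGroup_iff']
    ext i j
    have := orthonormal_iff_ite.mp b.orthonormal i j
    rw [Matrix.one_apply, ← this]
    simp [Matrix.mul_apply, PiLp.inner_apply, star_eq_conjTranspose, mul_comm]
  · intro i j
    simp [hb (Sum.inl j) ⟨j, rfl⟩, v]

theorem postselected_prep_rank_sufficient {d₁ d₂ : ℕ}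
    (Sin : Matrix (Fin d₁ ⊕ Fin d₂) (Fin d₁ ⊕ Fin d₂) ℂ) (hSin : Sinᵀ = Sin)
    (hSne : Sin ≠ 0)
    (C : Matrix (Fin d₁) (Fin d₂) ℂ) (hrank : C.rank ≤ Sin.rank) :
    ∃ (a : ℕ) (U : Matrix ((Fin d₁ ⊕ Fin d₂) ⊕ Fin a) ((Fin d₁ ⊕ Fin d₂) ⊕ Fin a) ℂ),
      U ∈ Matrix.unitaryGroup ((Fin d₁ ⊕ Fin d₂) ⊕ Fin a) ℂ ∧
      ∃ α : ℝ, 0 < α ∧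
        ∀ (i : Fin d₁) (j : Fin d₂),
          (Uᵀ * Matrix.fromBlocks Sin 0 0 (0 : Matrix (Fin a) (Fin a) ℂ) * U)
              (Sum.inl (Sum.inl i)) (Sum.inl (Sum.inr j)) = (α : ℂ) * C i j := by
  obtain ⟨P, Q, hPQ⟩ := aux_factor Sin C hrank
  obtain ⟨t, ht, B, hB⟩ := aux_contr (Matrix.fromCols Pᵀ Q)
  let e : Fin (d₁ + d₂) ≃ Fin d₁ ⊕ Fin d₂ := finSumFinEquiv.symm
  have hB' : (B.submatrix e id)ᴴ * (B.submatrix e id) = Bᴴ * B := by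
    rw [Matrix.conjTranspose_submatrix, Matrix.submatrix_mul_equiv, Matrix.submatrix_id_id]
  rw [← hB'] at hB
  obtain ⟨U, hU, hUV⟩ := aux_unitary _ _ hB
  refine ⟨d₁ + d₂, U, hU, t ^ 2, by positivity, fun i j => ?_⟩
  rw [← hPQ]
  simp only [Matrix.mul_apply, Fintype.sum_sum_type (α₁ := Fin d₁ ⊕ Fin d₂), Matrix.transpose_apply,
    Matrix.fromBlocks_apply₁₁, Matrix.fromBlocks_apply₁₂, Matrix.fromBlocks_apply₂₁,
    Matrix.fromBlocks_apply₂₂, hUV, Matrix.zero_apply, mul_zero, zero_mul,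
    Finset.sum_const_zero, add_zero, Matrix.smul_apply, Matrix.fromCols_apply_inl,
    Matrix.fromCols_apply_inr, smul_eq_mul]
  rw [Finset.mul_sum]
  refine Finset.sum_congr rfl fun x _ => ?_
  rw [Finset.sum_mul, Finset.sum_mul, Finset.mul_sum]
  refine Finset.sum_congr rfl fun y _ => ?_
  push_cast
  ring
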